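/- Fix a positive integer D. Then, as X → ∞, (1/(X*·log(√D·X)))·∑_{f ∈ F(X)} 2·log|f| = log(16X²/e²)/log(√D·X) + O(1/(X^{1/2}·log X)); here e is Euler's number and the implied constant may depend on D. -/

import Mathlib

open Filter Asymptotics

/-- An integer `f` is a fundamental discriminant if either `f ≡ 1 (mod 4)` and `f` is
squarefree, or `f = 4m` with `m` squarefree and `m ≡ 2` or `3 (mod 4)`. -/
def IsFundamentalDiscriminant (f : ℤ) : Prop :=
  (f % 4 = 1 ∧ Squarefree f) ∨
  (∃ m : ℤ, f = 4 * m ∧ Squarefree m ∧ (m % 4 = 2 ∨ m % 4 = 3))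

/-- `F(X)`: the set of fundamental discriminants `f` with `gcd(f, D) = 1` and
`X ≤ |f| < 2X`. -/
def FSet (D : ℕ) (X : ℝ) : Set ℤ :=
  {f | IsFundamentalDiscriminant f ∧ IsCoprime f (D : ℤ) ∧
    X ≤ |(f : ℝ)| ∧ |(f : ℝ)| < 2 * X}

/-- `X* = #F(X)`. -/
noncomputable def Xstar (D : ℕ) (X : ℝ) : ℕ := (FSet D X).ncard

/-- The indicator of the squarefree integers coprime to `q`. -/
noncomputable def squarefreeCoprime (q k : ℕ) : ℝ :=
  if Squarefree k ∧ q.Coprime k then 1 else 0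

/-- The density of the squarefree integers coprime to `q`. -/
noncomputable def squarefreeCoprimeDensity (q : ℕ) : ℝ :=
  (q.totient / q : ℝ) *
    ∑' d : ℕ, if q.Coprime d then (ArithmeticFunction.moebius d : ℝ) / (d : ℝ) ^ 2 else 0

theorem card_coprime_Ico_add_mul (q r k : ℕ) :
    ((Finset.Ico 1 (1 + r + q * k)).filter q.Coprime).card =
      ((Finset.Ico 1 (1 + r)).filter q.Coprime).card + q.totient * k := by
  induction k with
  | zero => simp
  | succ k ih =>
    have h : Finset.Ico 1 (1 + r + q * (k + 1)) =
        Finset.Ico 1 (1 + r + q * k) ∪ Finset.Ico (1 + r + q * k) (1 + r + q * k + q) := by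
      rw [Finset.Ico_union_Ico_eq_Ico (by omega) (by omega)]; congr 1; ring
    rw [h, Finset.filter_union, Finset.card_union_of_disjoint, ih,
      Nat.filter_coprime_Ico_eq_totient]
    · ring
    · exact Finset.disjoint_filter_filter (Finset.Ico_disjoint_Ico_consecutive _ _ _)

theorem abs_card_coprime_sub_le {q : ℕ} (hq : 0 < q) (n : ℕ) :
    |(((Finset.Icc 1 n).filter q.Coprime).card : ℝ) - q.totient / q * n| ≤ q := by
  have h := card_coprime_Ico_add_mul q (n % q) (n / q)
  have hn : 1 + n % q + q * (n / q) = n + 1 := by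
    have := Nat.mod_add_div n q; omega
  rw [hn] at h
  have h1 : Finset.Icc 1 n = Finset.Ico 1 (n + 1) := rfl
  have hr : (n % q : ℕ) < q := Nat.mod_lt _ hq
  have hA : ((Finset.Ico 1 (1 + n % q)).filter q.Coprime).card ≤ n % q := by
    refine (Finset.card_filter_le _ _).trans ?_
    simp
  rw [h1, h]
  have hq' : (0 : ℝ) < q := by exact_mod_cast hq
  have hn' : (n : ℝ) = (n % q : ℕ) + q * (n / q : ℕ) := by
    exact_mod_cast (Nat.mod_add_div n q).symm
  have e : (q.totient / q * n : ℝ) = q.totient / q * (n % q : ℕ) + q.totient * (n / q : ℕ) := by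
    rw [hn']; field_simp
  have ht : (q.totient / q : ℝ) ≤ 1 := by
    rw [div_le_one hq']; exact_mod_cast Nat.totient_le q
  have ht0 : (0 : ℝ) ≤ q.totient / q := by positivity
  have hr' : ((n % q : ℕ) : ℝ) ≤ q := by exact_mod_cast hr.le
  have hr0 : (0 : ℝ) ≤ (n % q : ℕ) := by positivity
  have hA' : (((Finset.Ico 1 (1 + n % q)).filter q.Coprime).card : ℝ) ≤ (n % q : ℕ) := by
    exact_mod_cast hA
  have hA0 : (0 : ℝ) ≤ (((Finset.Ico 1 (1 + n % q)).filter q.Coprime).card : ℝ) := by positivity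
  rw [e]
  push_cast at *
  rw [abs_le]
  constructor <;> nlinarith

theorem sum_moebius_sq_dvd {n s : ℕ} (hn : n ≠ 0) (hs : n < (s + 1) ^ 2) :
    ∑ d ∈ (Finset.Icc 1 s).filter (fun d => d ^ 2 ∣ n), ArithmeticFunction.moebius d =
      if Squarefree n then 1 else 0 := by
  obtain ⟨a, b, rfl, ha⟩ := Nat.sq_mul_squarefree n
  have hb : b ≠ 0 := by rintro rfl; simp at hn
  have key : (Finset.Icc 1 s).filter (fun d => d ^ 2 ∣ b ^ 2 * a) = b.divisors := by
    ext d
    simp only [Finset.mem_filter, Finset.mem_Icc, Nat.mem_divisors]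
    constructor
    · rintro ⟨-, hd⟩
      refine ⟨?_, hb⟩
      by_contra hdb
      have hg : 0 < d.gcd b := Nat.gcd_pos_of_pos_right _ (Nat.pos_of_ne_zero hb)
      obtain ⟨d', b', hcop, hd', hb'⟩ := Nat.exists_coprime d b
      have h2 : d' ^ 2 ∣ b' ^ 2 * a := by
        have : d' ^ 2 * (d.gcd b) ^ 2 ∣ (b' ^ 2 * a) * (d.gcd b) ^ 2 := by
          have e1 : d' ^ 2 * (d.gcd b) ^ 2 = d ^ 2 := by rw [← mul_pow, ← hd']
          have e2 : (b' ^ 2 * a) * (d.gcd b) ^ 2 = b ^ 2 * a := by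
            conv_rhs => rw [hb']
            ring
          rw [e1, e2]; exact hd
        exact Nat.dvd_of_mul_dvd_mul_right (by positivity) this
      have h3 : d' ^ 2 ∣ a := (Nat.Coprime.pow 2 2 hcop).dvd_of_dvd_mul_left h2
      have h4 : d' = 1 := by
        have := ha d' (by rwa [← sq])
        exact Nat.isUnit_iff.1 this
      rw [h4, one_mul] at hd'
      exact hdb (hd' ▸ Nat.gcd_dvd_right d b)
    · rintro ⟨hd, -⟩
      have hdvd : d ^ 2 ∣ b ^ 2 * a := (pow_dvd_pow_of_dvd hd 2).mul_right a
      have hle := Nat.le_of_dvd (Nat.pos_of_ne_zero hn) hdvd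
      have := lt_of_pow_lt_pow_left₀ 2 (by omega) (hle.trans_lt hs)
      exact ⟨⟨Nat.pos_of_dvd_of_pos hd (Nat.pos_of_ne_zero hb), by omega⟩, hdvd⟩
  rw [key, ← ArithmeticFunction.coe_mul_zeta_apply, ArithmeticFunction.moebius_mul_coe_zeta,
    ArithmeticFunction.one_apply]
  congr 1
  refine propext ⟨?_, fun h => ?_⟩
  · rintro rfl; simpa using ha
  · exact Nat.isUnit_iff.1 (h b ⟨a, by ring⟩)

theorem card_coprime_sq_dvd (q n : ℕ) {d : ℕ} (hd : 0 < d) :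
    ((Finset.Icc 1 n).filter (fun m => q.Coprime m ∧ d ^ 2 ∣ m)).card =
      if q.Coprime d then ((Finset.Icc 1 (n / d ^ 2)).filter q.Coprime).card else 0 := by
  split_ifs with h
  · symm
    refine Finset.card_nbij (fun m => d ^ 2 * m) ?_ ?_ ?_
    · intro m hm
      simp only [Finset.mem_coe, Finset.mem_filter, Finset.mem_Icc] at hm ⊢
      refine ⟨⟨Nat.mul_pos (by positivity) hm.1.1, ?_⟩, ?_, Dvd.intro _ rfl⟩
      · rw [mul_comm]; exact (Nat.le_div_iff_mul_le (by positivity)).1 hm.1.2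
      · exact Nat.Coprime.mul_right (h.pow_right 2) hm.2
    · intro a _ b _ hab
      exact Nat.eq_of_mul_eq_mul_left (by positivity) hab
    · rintro m hm
      simp only [Finset.mem_coe, Finset.mem_filter, Finset.mem_Icc] at hm
      obtain ⟨⟨h1, h2⟩, h3, k, rfl⟩ := hm
      refine ⟨k, ?_, rfl⟩
      simp only [Finset.mem_coe, Finset.mem_filter, Finset.mem_Icc]
      refine ⟨⟨Nat.pos_of_mul_pos_left h1, ?_⟩, h3.coprime_mul_left_right⟩
      rw [Nat.le_div_iff_mul_le (by positivity), mul_comm]; exact h2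
  · rw [Finset.card_eq_zero, Finset.filter_eq_empty_iff]
    rintro m - ⟨h1, h2⟩
    exact h (h1.coprime_dvd_right ((Dvd.intro_left d (by ring)).trans h2))

theorem sum_squarefreeCoprime_eq {q n s : ℕ} (hs : n < (s + 1) ^ 2) :
    ∑ k ∈ Finset.Icc 0 n, squarefreeCoprime q k =
      ∑ d ∈ Finset.Icc 1 s, if q.Coprime d then (ArithmeticFunction.moebius d : ℝ) *
        ((Finset.Icc 1 (n / d ^ 2)).filter q.Coprime).card else 0 := by
  have h0 : Finset.Icc 0 n = insert 0 (Finset.Icc 1 n) := by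
    ext; simp only [Finset.mem_insert, Finset.mem_Icc]; omega
  have h1 : ∀ k ∈ Finset.Icc 1 n, squarefreeCoprime q k =
      ∑ d ∈ Finset.Icc 1 s, if q.Coprime k ∧ d ^ 2 ∣ k
        then (ArithmeticFunction.moebius d : ℝ) else 0 := by
    intro k hk
    rw [Finset.mem_Icc] at hk
    have := sum_moebius_sq_dvd (n := k) (s := s) (by omega) (by omega)
    rw [Finset.sum_filter] at this
    by_cases hc : q.Coprime k
    · simp only [squarefreeCoprime, eq_true hc, and_true, true_and]
      exact_mod_cast this.symm
    · simp [squarefreeCoprime, hc]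
  rw [h0, Finset.sum_insert (by simp), Finset.sum_congr rfl h1, Finset.sum_comm]
  simp only [squarefreeCoprime, not_squarefree_zero, false_and, if_false, zero_add]
  refine Finset.sum_congr rfl fun d hd => ?_
  rw [← Finset.sum_filter, Finset.sum_const, card_coprime_sq_dvd q n (Finset.mem_Icc.1 hd).1]
  split_ifs <;> simp [mul_comm]

theorem abs_moebius_div_sq_le (q d : ℕ) :
    |if q.Coprime d then (ArithmeticFunction.moebius d : ℝ) / (d : ℝ) ^ 2 else 0| ≤
      1 / (d : ℝ) ^ 2 := by
  split_ifs
  · rw [abs_div, abs_of_nonneg (sq_nonneg (d : ℝ))]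
    gcongr
    exact_mod_cast ArithmeticFunction.abs_moebius_le_one
  · simp

theorem summable_moebius_div_sq (q : ℕ) : Summable fun d : ℕ =>
    if q.Coprime d then (ArithmeticFunction.moebius d : ℝ) / (d : ℝ) ^ 2 else 0 :=
  Summable.of_norm_bounded hasSum_zeta_two.summable (abs_moebius_div_sq_le q)

theorem squarefreeCoprimeDensity_pos {q : ℕ} (hq : 0 < q) : 0 < squarefreeCoprimeDensity q := by
  refine mul_pos (div_pos (by exact_mod_cast Nat.totient_pos.2 hq) (by exact_mod_cast hq)) ?_
  have hs := summable_moebius_div_sq q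
  have hz := hasSum_zeta_two
  have h1 : (∑' d : ℕ, if q.Coprime d then (ArithmeticFunction.moebius d : ℝ) / (d : ℝ) ^ 2 else 0)
      ≥ 2 - Real.pi ^ 2 / 6 := by
    have hsub : HasSum (fun d : ℕ => (if d = 1 then (2 : ℝ) else 0) - 1 / (d : ℝ) ^ 2)
        (2 - Real.pi ^ 2 / 6) := (hasSum_ite_eq 1 2).sub hz
    refine hasSum_le (fun d => ?_) hsub hs.hasSum
    by_cases hd : d = 1
    · subst hd; norm_num
    · have := neg_le_of_abs_le (abs_moebius_div_sq_le q d)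
      simp only [hd, if_false]; linarith
  nlinarith [Real.pi_lt_d2, Real.pi_pos]

theorem abs_tsum_sub_sum_moebius_div_sq_le (q s : ℕ) :
    |(∑' d : ℕ, if q.Coprime d then (ArithmeticFunction.moebius d : ℝ) / (d : ℝ) ^ 2 else 0) -
      ∑ d ∈ Finset.Icc 1 s,
        if q.Coprime d then (ArithmeticFunction.moebius d : ℝ) / (d : ℝ) ^ 2 else 0| ≤
      2 / (s + 1) := by
  set f : ℕ → ℝ := fun d =>
    if q.Coprime d then (ArithmeticFunction.moebius d : ℝ) / (d : ℝ) ^ 2 else 0 with hf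
  have hlim : Tendsto (fun N => |(∑ d ∈ Finset.range N, f d) - ∑ d ∈ Finset.Icc 1 s, f d|) atTop
      (nhds |(∑' d, f d) - ∑ d ∈ Finset.Icc 1 s, f d|) :=
    ((summable_moebius_div_sq q).hasSum.tendsto_sum_nat.sub_const _).abs
  refine le_of_tendsto hlim ?_
  filter_upwards [eventually_ge_atTop (s + 1)] with N hN
  have h0 : f 0 = 0 := by simp [hf]
  have e : Finset.range N = insert 0 (Finset.Icc 1 s) ∪ Finset.Ioo s N := by
    ext; simp only [Finset.mem_range, Finset.mem_union, Finset.mem_insert, Finset.mem_Icc,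
      Finset.mem_Ioo]; omega
  rw [e, Finset.sum_union, Finset.sum_insert (by simp), h0, zero_add, add_sub_cancel_left]
  · refine (Finset.abs_sum_le_sum_abs _ _).trans ?_
    refine (Finset.sum_le_sum fun d _ => abs_moebius_div_sq_le q d).trans ?_
    simpa using sum_Ioo_inv_sq_le (α := ℝ) s N
  · rw [Finset.disjoint_left]
    intro a; simp only [Finset.mem_insert, Finset.mem_Icc, Finset.mem_Ioo]; omega

theorem abs_sum_squarefreeCoprime_nat_sub_le {q : ℕ} (hq : 0 < q) (n : ℕ) :
    |∑ k ∈ Finset.Icc 0 n, squarefreeCoprime q k - squarefreeCoprimeDensity q * n| ≤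
      (q + 3) * Real.sqrt n := by
  set s := Nat.sqrt n with hs
  have hlt : n < (s + 1) ^ 2 := Nat.lt_succ_sqrt' n
  have hq' : (0 : ℝ) < q := by exact_mod_cast hq
  have ht : (q.totient / q : ℝ) ≤ 1 := by
    rw [div_le_one hq']; exact_mod_cast Nat.totient_le q
  have ht0 : (0 : ℝ) ≤ q.totient / q := by positivity
  set δ : ℝ := q.totient / q with hδ
  have hsn : (s : ℝ) ≤ Real.sqrt n := by
    apply Real.le_sqrt_of_sq_le; exact_mod_cast Nat.sqrt_le' n
  have hns : Real.sqrt n ≤ s + 1 := by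
    rw [Real.sqrt_le_left (by positivity)]; exact_mod_cast hlt.le
  set T : ℝ := ∑' d : ℕ, if q.Coprime d then
    (ArithmeticFunction.moebius d : ℝ) / (d : ℝ) ^ 2 else 0 with hT
  set P : ℝ := ∑ d ∈ Finset.Icc 1 s, if q.Coprime d then
    (ArithmeticFunction.moebius d : ℝ) / (d : ℝ) ^ 2 else 0 with hP
  have htail : |T - P| ≤ 2 / (s + 1) := abs_tsum_sub_sum_moebius_div_sq_le q s
  have hmain : |∑ k ∈ Finset.Icc 0 n, squarefreeCoprime q k - δ * n * P| ≤ (q + 1) * s := by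
    rw [sum_squarefreeCoprime_eq hlt, hP, Finset.mul_sum, ← Finset.sum_sub_distrib]
    refine (Finset.abs_sum_le_sum_abs _ _).trans ?_
    have : ∀ d ∈ Finset.Icc 1 s, |(if q.Coprime d then (ArithmeticFunction.moebius d : ℝ) *
        ((Finset.Icc 1 (n / d ^ 2)).filter q.Coprime).card else 0) - δ * n *
        (if q.Coprime d then (ArithmeticFunction.moebius d : ℝ) / (d : ℝ) ^ 2 else 0)| ≤
        (q + 1 : ℝ) := by
      intro d hd
      have hd0 : 0 < d := (Finset.mem_Icc.1 hd).1
      split_ifs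
      · have hA := abs_card_coprime_sub_le hq (n / d ^ 2)
        have hfl : |((n / d ^ 2 : ℕ) : ℝ) - n / (d : ℝ) ^ 2| ≤ 1 := by
          have h1 : ((n / d ^ 2 : ℕ) : ℝ) ≤ n / (d : ℝ) ^ 2 := by
            exact_mod_cast Nat.cast_div_le (α := ℝ) (m := n) (n := d ^ 2)
          have h2 : (n / (d : ℝ) ^ 2) < ((n / d ^ 2 : ℕ) : ℝ) + 1 := by
            rw [div_lt_iff₀ (by positivity)]
            have := Nat.lt_mul_div_succ n (show 0 < d ^ 2 by positivity)
            rw [mul_comm] at this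
            exact_mod_cast this
          rw [abs_le]; constructor <;> linarith
        have e : (ArithmeticFunction.moebius d : ℝ) *
            ((Finset.Icc 1 (n / d ^ 2)).filter q.Coprime).card - δ * n *
            ((ArithmeticFunction.moebius d : ℝ) / (d : ℝ) ^ 2) =
            (ArithmeticFunction.moebius d : ℝ) *
            ((((Finset.Icc 1 (n / d ^ 2)).filter q.Coprime).card - δ * (n / d ^ 2 : ℕ)) +
              δ * ((n / d ^ 2 : ℕ) - n / (d : ℝ) ^ 2)) := by ring
        rw [e, abs_mul]
        have hμ : |(ArithmeticFunction.moebius d : ℝ)| ≤ 1 := by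
          exact_mod_cast ArithmeticFunction.abs_moebius_le_one
        have h3 : |δ * (((n / d ^ 2 : ℕ) : ℝ) - n / (d : ℝ) ^ 2)| ≤ 1 := by
          rw [abs_mul, abs_of_nonneg ht0]
          exact mul_le_one₀ ht (abs_nonneg _) hfl
        calc _ ≤ 1 * ((q : ℝ) + 1) := by
              refine mul_le_mul hμ ((abs_add_le _ _).trans (add_le_add hA h3)) (abs_nonneg _)
                zero_le_one
          _ = _ := one_mul _
      · simp only [mul_zero, sub_zero, abs_zero]; positivity
    refine (Finset.sum_le_sum this).trans ?_
    simp only [Finset.sum_const, Nat.card_Icc, Nat.add_sub_cancel, nsmul_eq_mul]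
    rw [mul_comm]
  have e : ∑ k ∈ Finset.Icc 0 n, squarefreeCoprime q k - squarefreeCoprimeDensity q * n =
      (∑ k ∈ Finset.Icc 0 n, squarefreeCoprime q k - δ * n * P) - δ * (n * (T - P)) := by
    simp only [squarefreeCoprimeDensity]; ring
  have h4 : |δ * (n * (T - P))| ≤ 2 * Real.sqrt n := by
    rw [abs_mul, abs_mul, abs_of_nonneg ht0, abs_of_nonneg (Nat.cast_nonneg n)]
    have h5 : (n : ℝ) * |T - P| ≤ 2 * Real.sqrt n := by
      calc (n : ℝ) * |T - P| ≤ n * (2 / (s + 1)) := by gcongr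
        _ = Real.sqrt n * Real.sqrt n * (2 / (s + 1)) := by
            rw [Real.mul_self_sqrt (Nat.cast_nonneg n)]
        _ ≤ Real.sqrt n * (s + 1) * (2 / (s + 1)) := by gcongr
        _ = 2 * Real.sqrt n := by field_simp
    calc _ ≤ 1 * (2 * Real.sqrt n) := by gcongr
      _ = _ := one_mul _
  rw [e]
  refine (abs_sub _ _).trans ?_
  nlinarith

theorem abs_sum_squarefreeCoprime_sub_le {q : ℕ} (hq : 0 < q) {t : ℝ} (ht : 1 ≤ t) :
    |∑ k ∈ Finset.Icc 0 ⌊t⌋₊, squarefreeCoprime q k - squarefreeCoprimeDensity q * t| ≤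
      (q + 3 + squarefreeCoprimeDensity q) * Real.sqrt t := by
  have hc := squarefreeCoprimeDensity_pos hq
  have h := abs_sum_squarefreeCoprime_nat_sub_le hq ⌊t⌋₊
  have h1 : (⌊t⌋₊ : ℝ) ≤ t := Nat.floor_le (by linarith)
  have h2 : t < ⌊t⌋₊ + 1 := Nat.lt_floor_add_one t
  have h3 : Real.sqrt ⌊t⌋₊ ≤ Real.sqrt t := Real.sqrt_le_sqrt h1
  have h4 : 1 ≤ Real.sqrt t := Real.one_le_sqrt.2 ht
  have h5 : ((q : ℝ) + 3) * Real.sqrt ⌊t⌋₊ ≤ (q + 3) * Real.sqrt t := by gcongr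
  rw [abs_le] at h ⊢
  constructor <;> nlinarith

theorem abs_sum_Ico_ceil_sub_sum_Ioc_floor_le (g : ℕ → ℝ) {X : ℝ} (hX : 0 ≤ X) {B : ℝ}
    (hB : ∀ k : ℕ, ((k : ℝ) = X ∨ (k : ℝ) = 2 * X) → |g k| ≤ B) (hB0 : 0 ≤ B) :
    |∑ k ∈ Finset.Ico ⌈X⌉₊ ⌈2 * X⌉₊, g k - ∑ k ∈ Finset.Ioc ⌊X⌋₊ ⌊2 * X⌋₊, g k| ≤ 2 * B := by
  have hone : ∀ Y : ℝ, 0 ≤ Y → (Y = X ∨ Y = 2 * X) →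
      |∑ k ∈ Finset.range (⌊Y⌋₊ + 1), g k - ∑ k ∈ Finset.range ⌈Y⌉₊, g k| ≤ B := by
    intro Y hY hYX
    rcases (Nat.ceil_le_floor_add_one Y).eq_or_lt with h | h
    · simpa [h] using hB0
    · have h' : ⌈Y⌉₊ = ⌊Y⌋₊ := le_antisymm (by omega) (Nat.floor_le_ceil Y)
      have hval : (⌊Y⌋₊ : ℝ) = Y := by
        refine le_antisymm (Nat.floor_le hY) ?_
        rw [← h']; exact Nat.le_ceil Y
      rw [h', Finset.sum_range_succ, add_sub_cancel_left]
      exact hB _ (by rwa [hval])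
  have h1 := hone X hX (Or.inl rfl)
  have h2 := hone (2 * X) (by linarith) (Or.inr rfl)
  have e : Finset.Ioc ⌊X⌋₊ ⌊2 * X⌋₊ = Finset.Ico (⌊X⌋₊ + 1) (⌊2 * X⌋₊ + 1) := by
    ext; simp only [Finset.mem_Ioc, Finset.mem_Ico]; omega
  have hfl : ⌊X⌋₊ ≤ ⌊2 * X⌋₊ := Nat.floor_le_floor (by linarith)
  have hce : ⌈X⌉₊ ≤ ⌈2 * X⌉₊ := Nat.ceil_le_ceil (by linarith)
  rw [e, Finset.sum_Ico_eq_sub _ hce, Finset.sum_Ico_eq_sub _ (by omega)]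
  rw [abs_le] at *
  constructor <;> linarith [h1.1, h1.2, h2.1, h2.2]

theorem abs_sum_Ico_log_div_sub_le {a : ℕ → ℝ} {C K : ℝ} (ha : ∀ k, |a k| ≤ 1) (hK : 0 ≤ K)
    (hN : ∀ t : ℝ, 1 ≤ t → |∑ k ∈ Finset.Icc 0 ⌊t⌋₊, a k - C * t| ≤ K * √t)
    {X : ℝ} (hX : 1 ≤ X) :
    |∑ k ∈ Finset.Ico ⌈X⌉₊ ⌈2 * X⌉₊, a k * (Real.log (k / X) - (2 * Real.log 2 - 1))| ≤
      (5 * K + 2) * √X := by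
  have hX0 : 0 < X := by linarith
  set κ : ℝ := 2 * Real.log 2 - 1 with hκ
  have l1 := Real.log_two_gt_d9
  have l2 := Real.log_two_lt_d9
  set f : ℝ → ℝ := fun t => Real.log (t / X) - κ with hf
  set N : ℝ → ℝ := fun t => ∑ k ∈ Finset.Icc 0 ⌊t⌋₊, a k with hNdef
  have hfX : f X = -κ := by simp [hf, hX0.ne']
  have hf2X : f (2 * X) = Real.log 2 - κ := by
    simp only [hf]; rw [mul_div_assoc, div_self hX0.ne', mul_one]
  have hsX : 1 ≤ √X := Real.one_le_sqrt.2 hX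
  have hs2 : √(2 * X) ≤ 2 * √X := by
    rw [Real.sqrt_le_left (by positivity), mul_pow, Real.sq_sqrt hX0.le]; linarith
  have hderiv : ∀ t ∈ Set.Icc X (2 * X), HasDerivAt f t⁻¹ t := by
    intro t ht
    have ht0 : 0 < t := hX0.trans_le ht.1
    have := ((hasDerivAt_id t).div_const X).log (by simp [ht0.ne', hX0.ne']) |>.sub_const κ
    exact this.congr_deriv (by simp only [id]; field_simp)
  have hinv : MeasureTheory.IntegrableOn (fun t : ℝ => t⁻¹) (Set.Icc X (2 * X)) := by
    refine ContinuousOn.integrableOn_Icc (continuousOn_id.inv₀ fun t ht => ?_)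
    exact (hX0.trans_le ht.1).ne'
  have hint : MeasureTheory.IntegrableOn (deriv f) (Set.Icc X (2 * X)) :=
    hinv.congr_fun (fun t ht => (hderiv t ht).deriv.symm) measurableSet_Icc
  have habel := sum_mul_eq_sub_sub_integral_mul a (f := f) hX0.le (by linarith : X ≤ 2 * X)
    (fun t ht => (hderiv t ht).differentiableAt) hint
  have hIcong : ∫ t in Set.Ioc X (2 * X), deriv f t * ∑ k ∈ Finset.Icc 0 ⌊t⌋₊, a k =
      ∫ t in Set.Ioc X (2 * X), t⁻¹ * N t := by
    refine MeasureTheory.setIntegral_congr_fun measurableSet_Ioc fun t ht => ?_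
    simp only [(hderiv t ⟨ht.1.le, ht.2⟩).deriv, hNdef]
  have hNint : MeasureTheory.IntegrableOn (fun t => t⁻¹ * N t) (Set.Ioc X (2 * X)) :=
    (integrableOn_mul_sum_Icc a hX0.le hinv).mono_set Set.Ioc_subset_Icc_self
  have hCint : ∫ _ in Set.Ioc X (2 * X), C = C * X := by
    rw [MeasureTheory.setIntegral_const, Real.volume_real_Ioc_of_le (by linarith), smul_eq_mul]
    ring
  have hI : |(∫ t in Set.Ioc X (2 * X), t⁻¹ * N t) - C * X| ≤ 2 * K * √X := by
    rw [← hCint, ← MeasureTheory.integral_sub hNint (by simp)]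
    have hb : ∀ t ∈ Set.Ioc X (2 * X), ‖t⁻¹ * N t - C‖ ≤ X⁻¹ * (K * (2 * √X)) := by
      intro t ht
      have ht0 : 0 < t := hX0.trans ht.1
      have e : t⁻¹ * N t - C = t⁻¹ * (N t - C * t) := by field_simp
      rw [e, Real.norm_eq_abs, abs_mul, abs_of_pos (inv_pos.2 ht0)]
      have hle : √t ≤ 2 * √X := (Real.sqrt_le_sqrt ht.2).trans hs2
      refine mul_le_mul (inv_anti₀ hX0 ht.1.le) ((hN t (hX.trans ht.1.le)).trans ?_)
        (abs_nonneg _) (inv_nonneg.2 hX0.le)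
      gcongr
    have := MeasureTheory.norm_setIntegral_le_of_norm_le_const (μ := MeasureTheory.volume)
      (by simp) hb
    rw [Real.norm_eq_abs] at this
    refine this.trans (le_of_eq ?_)
    rw [Real.volume_real_Ioc_of_le (by linarith)]
    field_simp; ring
  have hNX := hN X hX
  have hN2X := hN (2 * X) (by linarith)
  have hN2X' : |N (2 * X) - C * (2 * X)| ≤ 2 * K * √X :=
    hN2X.trans (by nlinarith)
  have hend := abs_sum_Ico_ceil_sub_sum_Ioc_floor_le
    (fun k => a k * (Real.log (k / X) - κ)) hX0.le (B := 1) (by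
      rintro k (hk | hk)
      · have : |f X| ≤ 1 := by rw [hfX, abs_le]; constructor <;> linarith
        rw [abs_mul, hk]; exact mul_le_one₀ (ha k) (abs_nonneg _) this
      · have : |f (2 * X)| ≤ 1 := by rw [hf2X, abs_le]; constructor <;> linarith
        rw [abs_mul, hk]; exact mul_le_one₀ (ha k) (abs_nonneg _) this) zero_le_one
  have hIoc : ∑ k ∈ Finset.Ioc ⌊X⌋₊ ⌊2 * X⌋₊, a k * (Real.log (k / X) - κ) =
      (Real.log 2 - κ) * (N (2 * X) - C * (2 * X)) + κ * (N X - C * X) -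
        ((∫ t in Set.Ioc X (2 * X), t⁻¹ * N t) - C * X) := by
    rw [hIcong, hfX, hf2X] at habel
    have : ∑ k ∈ Finset.Ioc ⌊X⌋₊ ⌊2 * X⌋₊, a k * (Real.log (k / X) - κ) =
        ∑ k ∈ Finset.Ioc ⌊X⌋₊ ⌊2 * X⌋₊, f k * a k :=
      Finset.sum_congr rfl fun k _ => mul_comm _ _
    rw [this, habel]
    simp only [hNdef, hκ]; ring
  have hA : |(Real.log 2 - κ) * (N (2 * X) - C * (2 * X))| ≤ 2 * K * √X := by
    rw [abs_mul]
    refine (mul_le_of_le_one_left (abs_nonneg _) ?_).trans hN2X'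
    rw [abs_le]; constructor <;> linarith
  have hB : |κ * (N X - C * X)| ≤ K * √X := by
    rw [abs_mul]
    refine (mul_le_of_le_one_left (abs_nonneg _) ?_).trans hNX
    rw [abs_le]; constructor <;> linarith
  rw [hIoc] at hend
  rw [abs_le] at hend hA hB hI ⊢
  constructor <;> linarith [hend.1, hend.2, hA.1, hA.2, hB.1, hB.2, hI.1, hI.2]

theorem le_sum_Ico_of_abs_sum_sub_le {a : ℕ → ℝ} {C K : ℝ} (ha : ∀ k, |a k| ≤ 1) (hK : 0 ≤ K)
    (hN : ∀ t : ℝ, 1 ≤ t → |∑ k ∈ Finset.Icc 0 ⌊t⌋₊, a k - C * t| ≤ K * √t)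
    {X : ℝ} (hX : 1 ≤ X) :
    C * X - (3 * K + 2) * √X ≤ ∑ k ∈ Finset.Ico ⌈X⌉₊ ⌈2 * X⌉₊, a k := by
  have hX0 : 0 < X := by linarith
  have hsX : 1 ≤ √X := Real.one_le_sqrt.2 hX
  have hs2 : √(2 * X) ≤ 2 * √X := by
    rw [Real.sqrt_le_left (by positivity), mul_pow, Real.sq_sqrt hX0.le]; linarith
  have hend := abs_sum_Ico_ceil_sub_sum_Ioc_floor_le a hX0.le (B := 1) (fun k _ => ha k)
    zero_le_one
  have hfl : ⌊X⌋₊ ≤ ⌊2 * X⌋₊ := Nat.floor_le_floor (by linarith)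
  have e : ∑ k ∈ Finset.Ioc ⌊X⌋₊ ⌊2 * X⌋₊, a k =
      ∑ k ∈ Finset.Icc 0 ⌊2 * X⌋₊, a k - ∑ k ∈ Finset.Icc 0 ⌊X⌋₊, a k := by
    have h1 : Finset.Icc 0 ⌊2 * X⌋₊ = Finset.Icc 0 ⌊X⌋₊ ∪ Finset.Ioc ⌊X⌋₊ ⌊2 * X⌋₊ := by
      ext; simp only [Finset.mem_union, Finset.mem_Icc, Finset.mem_Ioc]; omega
    rw [h1, Finset.sum_union, add_sub_cancel_left]
    rw [Finset.disjoint_left]; intro k; simp only [Finset.mem_Icc, Finset.mem_Ioc]; omega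
  have hNX := hN X hX
  have hN2X : |∑ k ∈ Finset.Icc 0 ⌊2 * X⌋₊, a k - C * (2 * X)| ≤ 2 * K * √X :=
    (hN (2 * X) (by linarith)).trans (by nlinarith)
  rw [e] at hend
  rw [abs_le] at hend hNX hN2X
  linarith [hend.1, hNX.2, hN2X.1]

theorem finite_FSet (D : ℕ) (X : ℝ) : (FSet D X).Finite := by
  refine (Set.finite_Icc (-(⌈2 * X⌉₊ : ℤ)) ⌈2 * X⌉₊).subset fun f hf => ?_
  have h : |f| ≤ (⌈2 * X⌉₊ : ℤ) := by
    have := hf.2.2.2.le.trans (Nat.le_ceil (2 * X))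
    exact_mod_cast this
  exact abs_le.1 h

theorem mem_FSet_iff {D e k : ℕ} {X : ℝ} {f : ℤ} (he : 0 < e) (heD : e.Coprime D)
    (hf : f.natAbs = e * k) :
    f ∈ FSet D X ↔ IsFundamentalDiscriminant f ∧ D.Coprime k ∧
      k ∈ Finset.Ico ⌈X / e⌉₊ ⌈2 * (X / e)⌉₊ := by
  have habs : |(f : ℝ)| = e * k := by
    rw [← Int.cast_abs, Int.abs_eq_natAbs, hf]; push_cast; rfl
  have he' : (0 : ℝ) < e := by exact_mod_cast he
  have hcop : IsCoprime f (D : ℤ) ↔ D.Coprime k := by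
    rw [Int.isCoprime_iff_gcd_eq_one, Int.gcd_def, hf, Int.natAbs_natCast, ← Nat.coprime_iff_gcd_eq_one,
      Nat.coprime_mul_iff_left]
    exact ⟨fun h => h.2.symm, fun h => ⟨heD, h.symm⟩⟩
  rw [Finset.mem_Ico, Nat.ceil_le, Nat.lt_ceil, div_le_iff₀ he', ← mul_div_assoc, lt_div_iff₀ he',
    ← hcop, mul_comm (k : ℝ), ← habs]
  rfl

theorem sum_abs_eq_sum_squarefreeCoprime {D e : ℕ} {X : ℝ} (he : 0 < e) (heD : e.Coprime D)
    (S : Finset ℤ) (j : ℕ → ℤ) (hj : ∀ k, (j k).natAbs = e * k)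
    (hjS : ∀ k, Squarefree k → k % 2 = 1 → j k ∈ FSet D X → j k ∈ S)
    (hjF : ∀ k, Squarefree k → k % 2 = 1 → IsFundamentalDiscriminant (j k))
    (hSF : ∀ f ∈ S, f ∈ FSet D X)
    (hS : ∀ f ∈ S, ∃ k, Squarefree k ∧ k % 2 = 1 ∧ j k = f) (h : ℝ → ℝ) :
    ∑ f ∈ S, h |(f : ℝ)| =
      ∑ k ∈ Finset.Ico ⌈X / e⌉₊ ⌈2 * (X / e)⌉₊, squarefreeCoprime (2 * D) k * h (e * k) := by
  have e1 : ∀ k, squarefreeCoprime (2 * D) k * h (e * k) =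
      if (Squarefree k ∧ k % 2 = 1 ∧ D.Coprime k) then h (e * k) else 0 := by
    intro k
    have : (2 * D).Coprime k ↔ k % 2 = 1 ∧ D.Coprime k := by
      rw [Nat.coprime_mul_iff_left, Nat.coprime_two_left, Nat.odd_iff]
    simp only [squarefreeCoprime, this]
    split_ifs <;> simp
  simp only [e1]
  rw [← Finset.sum_filter]
  symm
  refine Finset.sum_nbij j ?_ ?_ ?_ ?_
  · intro k hk
    obtain ⟨h1, h2, h3, h4⟩ := Finset.mem_filter.1 hk
    exact hjS k h2 h3 ((mem_FSet_iff he heD (hj k)).2 ⟨hjF k h2 h3, h4, h1⟩)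
  · intro a _ b _ hab
    have := hj a
    rw [show j a = j b from hab, hj b] at this
    exact (Nat.eq_of_mul_eq_mul_left he this).symm
  · intro f hf
    obtain ⟨k, h1, h2, rfl⟩ := hS f hf
    obtain ⟨-, h4, h5⟩ := (mem_FSet_iff he heD (hj k)).1 (hSF _ hf)
    exact ⟨k, Finset.mem_coe.2 (Finset.mem_filter.2 ⟨h5, h1, h2, h4⟩), rfl⟩
  · intro k _
    rw [← Int.cast_abs, Int.abs_eq_natAbs, hj]; push_cast; rfl

theorem IsFundamentalDiscriminant.cases {f : ℤ} (hf : IsFundamentalDiscriminant f) :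
    (f % 4 = 1 ∧ Squarefree f.natAbs) ∨
    (∃ k : ℕ, Squarefree k ∧ k % 2 = 1 ∧ f % 8 = 4 ∧ f = 4 * (if k % 4 = 3 then (k : ℤ) else -k)) ∨
    (∃ k : ℕ, Squarefree k ∧ k % 2 = 1 ∧ (f = 8 * k ∨ f = -(8 * k))) := by
  rcases hf with ⟨h1, h2⟩ | ⟨m, rfl, h2, h3 | h3⟩
  · exact Or.inl ⟨h1, Int.squarefree_natAbs.2 h2⟩
  · right; right
    refine ⟨m.natAbs / 2, ?_, by omega, by omega⟩
    exact (Int.squarefree_natAbs.2 h2).squarefree_of_dvd (Nat.div_dvd_of_dvd (by omega))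
  · right; left
    refine ⟨m.natAbs, Int.squarefree_natAbs.2 h2, by omega, by omega, ?_⟩
    split_ifs <;> omega

theorem isFundamentalDiscriminant_eight_mul {k : ℕ} {f : ℤ} (hk : Squarefree k) (hk2 : k % 2 = 1)
    (hf : f = 8 * k ∨ f = -(8 * k)) : IsFundamentalDiscriminant f := by
  have h : ∀ m : ℤ, m.natAbs = 2 * k → Squarefree m := by
    intro m hm
    rw [← Int.squarefree_natAbs, hm, Nat.squarefree_mul]
    · exact ⟨Nat.prime_two.squarefree, hk⟩
    · rw [Nat.coprime_two_left, Nat.odd_iff]; exact hk2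
  rcases hf with rfl | rfl
  · exact Or.inr ⟨2 * k, by ring, h _ (by omega), by omega⟩
  · exact Or.inr ⟨-(2 * k), by ring, h _ (by omega), by omega⟩

theorem sum_FSet_eq (D : ℕ) (X : ℝ) (h : ℝ → ℝ) :
    ∑ f ∈ (finite_FSet D X).toFinset, h |(f : ℝ)| =
      ∑ k ∈ Finset.Ico ⌈X⌉₊ ⌈2 * X⌉₊, squarefreeCoprime (2 * D) k * h k +
      if Odd D then
        ∑ k ∈ Finset.Ico ⌈X / 4⌉₊ ⌈2 * (X / 4)⌉₊, squarefreeCoprime (2 * D) k * h (4 * k) +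
        2 * ∑ k ∈ Finset.Ico ⌈X / 8⌉₊ ⌈2 * (X / 8)⌉₊, squarefreeCoprime (2 * D) k * h (8 * k)
      else 0 := by
  classical
  set F := (finite_FSet D X).toFinset with hF
  have hmem : ∀ f, f ∈ F ↔ f ∈ FSet D X := fun f => (finite_FSet D X).mem_toFinset
  have hA : ∑ f ∈ F.filter (fun f => f % 4 = 1), h |(f : ℝ)| =
      ∑ k ∈ Finset.Ico ⌈X⌉₊ ⌈2 * X⌉₊, squarefreeCoprime (2 * D) k * h k := by
    have := sum_abs_eq_sum_squarefreeCoprime (D := D) (X := X) one_pos (Nat.coprime_one_left D)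
      (F.filter (fun f => f % 4 = 1)) (fun k => if k % 4 = 1 then (k : ℤ) else -k)
      (fun k => by split_ifs <;> omega)
      (fun k _ hk hkF => by
        rw [Finset.mem_filter, hmem]; exact ⟨hkF, by split_ifs <;> omega⟩)
      (fun k hs hk => Or.inl ⟨by split_ifs <;> omega, by
        rw [← Int.squarefree_natAbs]; split_ifs <;> simpa using hs⟩)
      (fun f hf => (hmem f).1 (Finset.mem_filter.1 hf).1)
      (fun f hf => by
        obtain ⟨h1, h2⟩ := Finset.mem_filter.1 hf
        rcases ((hmem f).1 h1).1.cases with ⟨-, h3⟩ | ⟨k, -, -, h4, -⟩ | ⟨k, -, -, h4⟩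
        · exact ⟨f.natAbs, h3, by omega, by split_ifs <;> omega⟩
        · omega
        · omega) h
    simpa using this
  rw [← Finset.sum_filter_add_sum_filter_not F (fun f => f % 4 = 1), hA]
  congr 1
  split_ifs with hD
  · have h2D : Nat.Coprime 2 D := Nat.coprime_two_left.2 hD
    have hB := sum_abs_eq_sum_squarefreeCoprime (D := D) (X := X) (e := 4) (by norm_num)
      (h2D.pow_left 2)
      ((F.filter (fun f => ¬ f % 4 = 1)).filter (fun f => f % 8 = 4))
      (fun k => 4 * (if k % 4 = 3 then (k : ℤ) else -k))
      (fun k => by split_ifs <;> omega)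
      (fun k _ hk hkF => by
        rw [Finset.mem_filter, Finset.mem_filter, hmem]
        exact ⟨⟨hkF, by split_ifs <;> omega⟩, by split_ifs <;> omega⟩)
      (fun k hs hk => Or.inr ⟨_, rfl, by
        rw [← Int.squarefree_natAbs]; split_ifs <;> simpa using hs, by split_ifs <;> omega⟩)
      (fun f hf => (hmem f).1 (Finset.mem_filter.1 (Finset.mem_filter.1 hf).1).1)
      (fun f hf => by
        obtain ⟨h0, h2⟩ := Finset.mem_filter.1 hf
        obtain ⟨h1, -⟩ := Finset.mem_filter.1 h0
        rcases ((hmem f).1 h1).1.cases with ⟨h3, -⟩ | ⟨k, h3, h4, -, h5⟩ | ⟨k, -, -, h4⟩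
        · omega
        · exact ⟨k, h3, h4, h5.symm⟩
        · omega) h
    have hC := sum_abs_eq_sum_squarefreeCoprime (D := D) (X := X) (e := 8) (by norm_num)
      (h2D.pow_left 3)
      (((F.filter (fun f => ¬ f % 4 = 1)).filter (fun f => ¬ f % 8 = 4)).filter (fun f => 0 < f))
      (fun k => 8 * (k : ℤ))
      (fun k => by omega)
      (fun k _ hk hkF => by
        rw [Finset.mem_filter, Finset.mem_filter, Finset.mem_filter, hmem]
        exact ⟨⟨⟨hkF, by omega⟩, by omega⟩, by omega⟩)
      (fun k hs hk => isFundamentalDiscriminant_eight_mul hs hk (Or.inl rfl))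
      (fun f hf => (hmem f).1
        (Finset.mem_filter.1 (Finset.mem_filter.1 (Finset.mem_filter.1 hf).1).1).1)
      (fun f hf => by
        obtain ⟨h0, h2⟩ := Finset.mem_filter.1 hf
        obtain ⟨h6, h7⟩ := Finset.mem_filter.1 h0
        obtain ⟨h1, h8⟩ := Finset.mem_filter.1 h6
        rcases ((hmem f).1 h1).1.cases with ⟨h3, -⟩ | ⟨k, -, -, h4, -⟩ | ⟨k, h3, h4, h5⟩
        · omega
        · omega
        · exact ⟨k, h3, h4, by omega⟩) h
    have hC' := sum_abs_eq_sum_squarefreeCoprime (D := D) (X := X) (e := 8) (by norm_num)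
      (h2D.pow_left 3)
      (((F.filter (fun f => ¬ f % 4 = 1)).filter (fun f => ¬ f % 8 = 4)).filter (fun f => ¬ 0 < f))
      (fun k => -(8 * (k : ℤ)))
      (fun k => by omega)
      (fun k _ hk hkF => by
        rw [Finset.mem_filter, Finset.mem_filter, Finset.mem_filter, hmem]
        exact ⟨⟨⟨hkF, by omega⟩, by omega⟩, by omega⟩)
      (fun k hs hk => isFundamentalDiscriminant_eight_mul hs hk (Or.inr rfl))
      (fun f hf => (hmem f).1
        (Finset.mem_filter.1 (Finset.mem_filter.1 (Finset.mem_filter.1 hf).1).1).1)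
      (fun f hf => by
        obtain ⟨h0, h2⟩ := Finset.mem_filter.1 hf
        obtain ⟨h6, h7⟩ := Finset.mem_filter.1 h0
        obtain ⟨h1, h8⟩ := Finset.mem_filter.1 h6
        rcases ((hmem f).1 h1).1.cases with ⟨h3, -⟩ | ⟨k, -, -, h4, -⟩ | ⟨k, h3, h4, h5⟩
        · omega
        · omega
        · exact ⟨k, h3, h4, by omega⟩) h
    rw [← Finset.sum_filter_add_sum_filter_not (F.filter (fun f => ¬ f % 4 = 1))
        (fun f => f % 8 = 4), hB,
      ← Finset.sum_filter_add_sum_filter_not _ (fun f : ℤ => 0 < f), hC, hC']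
    push_cast
    ring
  · refine Finset.sum_eq_zero fun f hf => ?_
    exfalso
    obtain ⟨h1, h2⟩ := Finset.mem_filter.1 hf
    rw [hmem] at h1
    have hfe : (2 : ℤ) ∣ f := by
      rcases h1.1.cases with ⟨h3, -⟩ | ⟨k, -, -, h4, -⟩ | ⟨k, -, -, h4⟩ <;> omega
    have hDe : (2 : ℤ) ∣ D := by rw [Nat.not_odd_iff_even, Nat.even_iff] at hD; omega
    have := h1.2.1.isUnit_of_dvd' hfe hDe
    rw [Int.isUnit_iff] at this
    omega

theorem abs_squarefreeCoprime_le_one (q k : ℕ) : |squarefreeCoprime q k| ≤ 1 := by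
  unfold squarefreeCoprime; split_ifs <;> simp

theorem squarefreeCoprime_nonneg (q k : ℕ) : 0 ≤ squarefreeCoprime q k := by
  unfold squarefreeCoprime; split_ifs <;> simp

theorem exists_abs_sum_FSet_log_le {D : ℕ} (hD : 0 < D) : ∃ M : ℝ, 0 ≤ M ∧ ∀ X : ℝ, 8 ≤ X →
    |∑ f ∈ (finite_FSet D X).toFinset,
      (Real.log (|(f : ℝ)| / X) - (2 * Real.log 2 - 1))| ≤ M * √X := by
  have hq : 0 < 2 * D := by omega
  have hc := squarefreeCoprimeDensity_pos hq
  set K : ℝ := (2 * D : ℕ) + 3 + squarefreeCoprimeDensity (2 * D) with hK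
  have hK0 : 0 ≤ K := by positivity
  refine ⟨4 * (5 * K + 2), by positivity, fun X hX => ?_⟩
  have key : ∀ e : ℝ, 1 ≤ e → e ≤ 8 →
      |∑ k ∈ Finset.Ico ⌈X / e⌉₊ ⌈2 * (X / e)⌉₊, squarefreeCoprime (2 * D) k *
        (Real.log (e * k / X) - (2 * Real.log 2 - 1))| ≤ (5 * K + 2) * √X := by
    intro e he he8
    have h := abs_sum_Ico_log_div_sub_le (abs_squarefreeCoprime_le_one (2 * D)) hK0
      (fun t ht => abs_sum_squarefreeCoprime_sub_le hq ht) (X := X / e)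
      (by rw [le_div_iff₀ (by linarith)]; linarith)
    have e1 : ∀ k : ℕ, (k : ℝ) / (X / e) = e * k / X := fun k => by
      rw [div_div_eq_mul_div, mul_comm]
    simp only [e1] at h
    refine h.trans ?_
    gcongr
    exact div_le_self (by linarith) he
  rw [sum_FSet_eq D X (fun t => Real.log (t / X) - (2 * Real.log 2 - 1))]
  have h1 := key 1 le_rfl (by norm_num)
  have h4 := key 4 (by norm_num) (by norm_num)
  have h8 := key 8 (by norm_num) le_rfl
  have hs : 0 ≤ (5 * K + 2) * √X := by positivity
  simp only [div_one, one_mul] at h1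
  split_ifs
  · rw [abs_le] at *
    constructor <;> linarith [h1.1, h1.2, h4.1, h4.2, h8.1, h8.2]
  · rw [abs_le] at *
    constructor <;> linarith [h1.1, h1.2]

theorem exists_le_Xstar {D : ℕ} (hD : 0 < D) :
    ∃ c : ℝ, 0 < c ∧ ∀ᶠ X : ℝ in atTop, c * X ≤ Xstar D X := by
  have hq : 0 < 2 * D := by omega
  have hc := squarefreeCoprimeDensity_pos hq
  set C := squarefreeCoprimeDensity (2 * D) with hC
  set K : ℝ := (2 * D : ℕ) + 3 + C with hK
  have hK0 : 0 ≤ K := by positivity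
  refine ⟨C / 2, by positivity, ?_⟩
  filter_upwards [eventually_ge_atTop 1, eventually_ge_atTop ((2 * (3 * K + 2) / C) ^ 2)]
    with X hX hX2
  have h := le_sum_Ico_of_abs_sum_sub_le (abs_squarefreeCoprime_le_one (2 * D)) hK0
      (fun t ht => abs_sum_squarefreeCoprime_sub_le hq ht) hX
  have hcard : (Xstar D X : ℝ) = ∑ f ∈ (finite_FSet D X).toFinset, (fun _ : ℝ => (1 : ℝ)) |(f : ℝ)| := by
    rw [Xstar, Set.ncard_eq_toFinset_card _ (finite_FSet D X)]; simp
  rw [hcard, sum_FSet_eq D X (fun _ => 1)]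
  have hle : (3 * K + 2) * √X ≤ C / 2 * X := by
    have h1 : 2 * (3 * K + 2) / C ≤ √X := Real.le_sqrt_of_sq_le hX2
    rw [div_le_iff₀ hc] at h1
    have h2 := Real.mul_self_sqrt (show 0 ≤ X by linarith)
    nlinarith [Real.sqrt_nonneg X]
  have hrest : 0 ≤ if Odd D then
        ∑ k ∈ Finset.Ico ⌈X / 4⌉₊ ⌈2 * (X / 4)⌉₊, squarefreeCoprime (2 * D) k * 1 +
        2 * ∑ k ∈ Finset.Ico ⌈X / 8⌉₊ ⌈2 * (X / 8)⌉₊, squarefreeCoprime (2 * D) k * 1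
      else (0 : ℝ) := by
    have hn : ∀ s : Finset ℕ, 0 ≤ ∑ k ∈ s, squarefreeCoprime (2 * D) k * 1 := fun s =>
      Finset.sum_nonneg fun k _ => by simpa using squarefreeCoprime_nonneg (2 * D) k
    split_ifs
    · have := hn (Finset.Ico ⌈X / 4⌉₊ ⌈2 * (X / 4)⌉₊)
      have := hn (Finset.Ico ⌈X / 8⌉₊ ⌈2 * (X / 8)⌉₊)
      positivity
    · exact le_rfl
  simp only [mul_one] at hrest ⊢
  linarith

/-- For fixed `D > 0`, as `X → ∞`,
`(1/(X*·log(√D·X)))·∑_{f ∈ F(X)} 2 log|f|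
  = log(16X²/e²)/log(√D·X) + O(1/(X^{1/2} log X))`. -/
theorem sum_two_log_abs_f (D : ℕ) (hD : 0 < D) :
    (fun X : ℝ =>
        (1 / ((Xstar D X : ℝ) * Real.log (Real.sqrt D * X))) *
            (∑ᶠ f ∈ FSet D X, 2 * Real.log |(f : ℝ)|)
          - Real.log (16 * X ^ 2 / Real.exp 1 ^ 2) / Real.log (Real.sqrt D * X))
      =O[atTop] fun X : ℝ => 1 / (X ^ ((1 : ℝ) / 2) * Real.log X) := by
  obtain ⟨M, hM0, hM⟩ := exists_abs_sum_FSet_log_le hD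
  obtain ⟨c, hc, hcX⟩ := exists_le_Xstar hD
  refine IsBigO.of_bound (2 * M / c) ?_
  filter_upwards [hcX, eventually_ge_atTop 8] with X hcX hX
  have hX0 : 0 < X := by linarith
  have hlogX : 0 < Real.log X := Real.log_pos (by linarith)
  have hsD : 1 ≤ √(D : ℝ) := Real.one_le_sqrt.2 (by exact_mod_cast hD)
  set L := Real.log (√(D : ℝ) * X) with hL
  have hLX : Real.log X ≤ L := Real.log_le_log hX0 (by nlinarith)
  have hL0 : 0 < L := hlogX.trans_le hLX
  have hN0 : (0 : ℝ) < Xstar D X := lt_of_lt_of_le (by positivity) hcX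
  have hS := hM X hX
  set S := ∑ f ∈ (finite_FSet D X).toFinset,
      (Real.log (|(f : ℝ)| / X) - (2 * Real.log 2 - 1)) with hSdef
  have hlog : Real.log (16 * X ^ 2 / Real.exp 1 ^ 2) =
      2 * (Real.log X + (2 * Real.log 2 - 1)) := by
    rw [show (16 : ℝ) * X ^ 2 / Real.exp 1 ^ 2 = (2 ^ 2 * X / Real.exp 1) ^ 2 by ring,
      Real.log_pow, Real.log_div (by positivity) (by positivity), Real.log_mul (by norm_num)
      hX0.ne', Real.log_pow, Real.log_exp]
    push_cast; ring
  have hsum : ∑ᶠ f ∈ FSet D X, 2 * Real.log |(f : ℝ)| =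
      2 * S + Xstar D X * Real.log (16 * X ^ 2 / Real.exp 1 ^ 2) := by
    rw [finsum_mem_eq_finite_toFinset_sum _ (finite_FSet D X), Xstar,
      Set.ncard_eq_toFinset_card _ (finite_FSet D X), hSdef, Finset.mul_sum, ← nsmul_eq_mul,
      ← Finset.sum_const, ← Finset.sum_add_distrib]
    refine Finset.sum_congr rfl fun f hf => ?_
    have hf' := ((finite_FSet D X).mem_toFinset.1 hf).2.2.1
    rw [hlog, Real.log_div (by linarith) hX0.ne']
    ring
  have e : 1 / ((Xstar D X : ℝ) * L) * (∑ᶠ f ∈ FSet D X, 2 * Real.log |(f : ℝ)|)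
      - Real.log (16 * X ^ 2 / Real.exp 1 ^ 2) / L = 2 * S / (Xstar D X * L) := by
    rw [hsum]; field_simp; ring
  rw [e, ← Real.sqrt_eq_rpow, Real.norm_eq_abs, Real.norm_eq_abs, abs_div, abs_mul,
    abs_of_pos (mul_pos hN0 hL0), abs_of_pos (show (0 : ℝ) < 2 by norm_num),
    abs_of_pos (show 0 < 1 / (√X * Real.log X) by positivity)]
  calc 2 * |S| / (Xstar D X * L) ≤ 2 * (M * √X) / (c * X * Real.log X) := by gcongr
    _ = 2 * M / c * (1 / (√X * Real.log X)) := by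
      have := Real.mul_self_sqrt hX0.le
      rw [div_mul_div_comm, mul_one, div_eq_div_iff (by positivity) (by positivity)]
      linear_combination (2 * M * c * Real.log X) * this
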